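/- (Lemma 1, converse, quantitative form.) Let λ, T > 0 and 0 < α, β < 1, and set the threshold U = √(λT/α). Suppose 0 < Δ < λ satisfies Δ·T ≥ U + √((λ − Δ)T/β). Consider the detector that rejects H₀ if and only if the observed packet count S satisfies S ≤ λT − U. Then its false alarm probability under the Poisson distribution with mean λT is at most α, and its missed detection probability under the Poisson distribution with mean (λ − Δ)T is at most β. -/

import Mathlib

/-- The Poisson probability mass function with mean `m`: `P(n) = e^{-m} mⁿ / n!`. -/
noncomputable def poissonPMF (m : ℝ) (n : ℕ) : ℝ :=
  Real.exp (-m) * m ^ n / n.factorial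

/-- The probability assigned by a pmf `P` on ℕ to a set `A ⊆ ℕ`. -/
noncomputable def pmfProb (P : ℕ → ℝ) (A : Set ℕ) : ℝ :=
  ∑' n : ℕ, A.indicator P n

theorem poissonPMF_nonneg {m : ℝ} (hm : 0 ≤ m) (n : ℕ) : 0 ≤ poissonPMF m n := by
  unfold poissonPMF
  positivity

theorem poissonPMF_succ (m : ℝ) (n : ℕ) :
    ((n + 1 : ℕ) : ℝ) * poissonPMF m (n + 1) = m * poissonPMF m n := by
  simp only [poissonPMF, Nat.factorial_succ, Nat.cast_mul, Nat.cast_succ]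
  field_simp
  ring

theorem hasSum_poissonPMF (m : ℝ) : HasSum (poissonPMF m) 1 := by
  have h := (NormedSpace.expSeries_div_hasSum_exp (𝔸 := ℝ) m).mul_left (Real.exp (-m))
  rw [← Real.exp_eq_exp_ℝ, ← Real.exp_add, neg_add_cancel, Real.exp_zero] at h
  refine h.congr_fun fun n => ?_
  simp only [poissonPMF, mul_div_assoc]

/-- The Stein-type identity `E[S g(S)] = m E[g(S + 1)]` of the Poisson distribution. -/
theorem hasSum_mul_poissonPMF {m s : ℝ} {g : ℕ → ℝ}
    (h : HasSum (fun n => g (n + 1) * poissonPMF m n) s) :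
    HasSum (fun n : ℕ => (n : ℝ) * g n * poissonPMF m n) (m * s) := by
  rw [← hasSum_nat_add_iff' 1]
  simp only [Finset.sum_range_one, Nat.cast_zero, zero_mul, sub_zero]
  refine (h.mul_left m).congr_fun fun n => ?_
  linear_combination g (n + 1) * poissonPMF_succ m n

theorem hasSum_sq_sub_mul_poissonPMF (m : ℝ) :
    HasSum (fun n : ℕ => ((n : ℝ) - m) ^ 2 * poissonPMF m n) m := by
  have h0 := hasSum_poissonPMF m
  have h1 : HasSum (fun n : ℕ => (n : ℝ) * poissonPMF m n) m := by
    have := hasSum_mul_poissonPMF (g := fun _ => 1) (by simpa using h0)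
    simpa using this
  have h2 : HasSum (fun n : ℕ => (n : ℝ) * n * poissonPMF m n) (m * (m + 1)) := by
    refine hasSum_mul_poissonPMF (g := fun n => (n : ℝ)) ?_
    refine (h1.add h0).congr_fun fun n => ?_
    push_cast
    ring
  have h := (h2.sub (h1.mul_left (2 * m))).add (h0.mul_left (m ^ 2))
  rw [show m * (m + 1) - 2 * m * m + m ^ 2 * 1 = m by ring] at h
  refine h.congr_fun fun n => ?_
  ring

/-- Chebyshev's inequality for the Poisson distribution. -/
theorem pmfProb_poissonPMF_le {m ε : ℝ} (hm : 0 < m) (hε : 0 < ε) {A : Set ℕ}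
    (hA : ∀ n ∈ A, √(m / ε) ≤ |(n : ℝ) - m|) : pmfProb (poissonPMF m) A ≤ ε := by
  have hs : HasSum (fun n : ℕ => ε / m * (((n : ℝ) - m) ^ 2 * poissonPMF m n)) ε := by
    simpa [hm.ne'] using (hasSum_sq_sub_mul_poissonPMF m).mul_left (ε / m)
  have hle : ∀ n : ℕ, A.indicator (poissonPMF m) n ≤
      ε / m * (((n : ℝ) - m) ^ 2 * poissonPMF m n) := by
    intro n
    have hp := poissonPMF_nonneg hm.le n
    by_cases hn : n ∈ A
    · rw [Set.indicator_of_mem hn, ← mul_assoc]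
      refine le_mul_of_one_le_left hp ?_
      have h : m / ε ≤ ((n : ℝ) - m) ^ 2 := by
        rw [← sq_abs]
        exact (Real.sqrt_le_left (abs_nonneg _)).1 (hA n hn)
      calc (1 : ℝ) = ε / m * (m / ε) := by field_simp
        _ ≤ _ := by gcongr
    · rw [Set.indicator_of_notMem hn]
      positivity
  exact hasSum_le hle ((hasSum_poissonPMF m).summable.indicator A).hasSum hs

/-- Lemma 1 (converse), quantitative form: with threshold `U = √(λT/α)`,
`0 < Δ < λ` and `ΔT ≥ U + √((λ−Δ)T/β)`, the detector rejecting iff the packet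
count `S` satisfies `S ≤ λT − U` has false alarm probability at most `α` under
Poisson(λT) and missed detection probability at most `β` under Poisson((λ−Δ)T). -/
theorem covert_buffering_converse (lam T Δ α β : ℝ) (hlam : 0 < lam) (hT : 0 < T)
    (hα0 : 0 < α) (hα1 : α < 1) (hβ0 : 0 < β) (hβ1 : β < 1)
    (hΔ0 : 0 < Δ) (hΔ1 : Δ < lam)
    (hΔ : Δ * T ≥ Real.sqrt (lam * T / α) + Real.sqrt ((lam - Δ) * T / β)) :
    pmfProb (poissonPMF (lam * T))
        {n : ℕ | (n : ℝ) ≤ lam * T - Real.sqrt (lam * T / α)} ≤ α ∧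
    pmfProb (poissonPMF ((lam - Δ) * T))
        {n : ℕ | (n : ℝ) ≤ lam * T - Real.sqrt (lam * T / α)}ᶜ ≤ β := by
  constructor
  · refine pmfProb_poissonPMF_le (mul_pos hlam hT) hα0 fun n hn => ?_
    rw [Set.mem_ofPred_eq] at hn
    rw [abs_sub_comm]
    exact le_trans (by linarith) (le_abs_self _)
  · refine pmfProb_poissonPMF_le (mul_pos (sub_pos.2 hΔ1) hT) hβ0 fun n hn => ?_
    rw [Set.mem_compl_iff, Set.mem_ofPred_eq, not_le] at hn
    exact le_trans (by linarith) (le_abs_self _)
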